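/- arXiv:1404.7411 — 3 statements merged into one kernel-verified Lean document; each statement's English description precedes it below -/
import Mathlib

section
/- For every integer m ≥ 1, set λ' := λ'_m, A := [−1, 1−λ'] and B := [λ'−1, −λ'] (closed intervals in ℝ). Then for every i with 0 ≤ i ≤ m the following inclusions hold: (⋃_{j=0}^{i−1} { λ'·x + j·λ' : x ∈ A }) ∪ { λ'·x : x ∈ B } ∪ (⋃_{j=i}^{m−1} { λ'·x + j·λ' + 1 : x ∈ A }) ⊆ A, and { λ'·x + i·λ' : x ∈ A } ⊆ B. Moreover the minimality condition λ'·((1−λ') + m) = λ' − 1 holds. -/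
/-- The conjugate `m - (m + √(m² + 4)) / 2` of a metallic mean lies in `(-1, 0)` and is a root of
`x² = m x + 1`. -/
theorem metallic_conj_bounds (m : ℝ) (hm : 0 < m) (l : ℝ)
    (hl : l = m - (m + Real.sqrt (m ^ 2 + 4)) / 2) :
    -1 < l ∧ l < 0 ∧ l ^ 2 = m * l + 1 := by
  have hs : Real.sqrt (m ^ 2 + 4) ^ 2 = m ^ 2 + 4 := Real.sq_sqrt (by positivity)
  have h0 := Real.sqrt_nonneg (m ^ 2 + 4)
  refine ⟨?_, ?_, ?_⟩
  · nlinarith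
  · nlinarith
  · subst hl
    nlinarith

theorem window_inclusions (m : ℕ) (hm : 1 ≤ m)
    (lam lam' : ℝ)
    (hlam : lam = (m + Real.sqrt (m ^ 2 + 4)) / 2)
    (hlam' : lam' = m - lam)
    (A B : Set ℝ)
    (hA : A = Set.Icc (-1) (1 - lam'))
    (hB : B = Set.Icc (lam' - 1) (-lam')) :
    (∀ i : ℕ, i ≤ m →
      ((⋃ j ∈ Finset.range i, (fun x : ℝ => lam' * x + j * lam') '' A) ∪
        ((fun x : ℝ => lam' * x) '' B) ∪
        (⋃ j ∈ Finset.Ico i m, (fun x : ℝ => lam' * x + j * lam' + 1) '' A))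
          ⊆ A ∧
      (fun x : ℝ => lam' * x + i * lam') '' A ⊆ B) ∧
    lam' * ((1 - lam') + m) = lam' - 1 := by
  obtain ⟨h1, h0, hq⟩ := metallic_conj_bounds m (by exact_mod_cast hm) lam' (by rw [hlam', hlam])
  subst hA hB
  have hneg : ∀ x a b : ℝ, x ∈ Set.Icc a b → lam' * b ≤ lam' * x ∧ lam' * x ≤ lam' * a :=
    fun x a b hx => ⟨mul_le_mul_of_nonpos_left hx.2 h0.le, mul_le_mul_of_nonpos_left hx.1 h0.le⟩
  have hnat : ∀ j : ℕ, (j : ℝ) * lam' ≤ 0 :=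
    fun j => mul_nonpos_of_nonneg_of_nonpos j.cast_nonneg h0.le
  have hmul : ∀ j k : ℕ, j ≤ k → (k : ℝ) * lam' ≤ j * lam' :=
    fun j k hjk => mul_le_mul_of_nonpos_right (by exact_mod_cast hjk) h0.le
  refine ⟨fun i hi => ⟨?_, ?_⟩, by linarith [hq]⟩
  · refine Set.union_subset (Set.union_subset (Set.iUnion₂_subset fun j hj => ?_) ?_)
      (Set.iUnion₂_subset fun j hj => ?_)
    · rintro _ ⟨x, hx, rfl⟩
      have hjm := hmul (j + 1) m (by have := Finset.mem_range.1 hj; omega)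
      push_cast at hjm
      obtain ⟨ha, hb⟩ := hneg x _ _ hx
      constructor <;> dsimp only <;> linarith [hnat j]
    · rintro _ ⟨x, hx, rfl⟩
      obtain ⟨ha, hb⟩ := hneg x _ _ hx
      constructor <;> dsimp only <;> nlinarith
    · rintro _ ⟨x, hx, rfl⟩
      have hjm := hmul (j + 1) m (by have := Finset.mem_Ico.1 hj; omega)
      push_cast at hjm
      obtain ⟨ha, hb⟩ := hneg x _ _ hx
      constructor <;> dsimp only <;> linarith [hnat j]
  · rintro _ ⟨x, hx, rfl⟩
    obtain ⟨ha, hb⟩ := hneg x _ _ hx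
    constructor <;> dsimp only <;> linarith [hnat i, hmul i m hi]
end

section
/- Let m ≥ 1 be an integer and p₀, p_m ∈ (0,1). Let M_{m,2} be the 4×4 real matrix with rows (m−1+p₀p_m, m−1+p₀, 1−p₀, 1), (1−p₀p_m, 1−p₀, p₀, 0), (1−p₀p_m, 1, 0, 0), (p₀p_m, 0, 0, 0), and let R_{m,2} be the vector with entries 2(λ_m−1)/D, 2(1−p₀p_m)/D, 2(1−p₀p_m)/D, 2(1+λ'_m)p₀p_m/D, where D := m(1+p₀p_m) − (2+2λ_m−m)(−1+p₀p_m). Then M_{m,2}.mulVec R_{m,2} = λ_m • R_{m,2}, all four entries of R_{m,2} are strictly positive, and the entries of R_{m,2} sum to 1. -/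
theorem induced_pf_eigenvector (m : ℕ) (hm : 1 ≤ m)
    (p₀ pm : ℝ) (hp₀ : p₀ ∈ Set.Ioo (0 : ℝ) 1) (hpm : pm ∈ Set.Ioo (0 : ℝ) 1)
    (lam lam' : ℝ)
    (hlam : lam = (m + Real.sqrt (m ^ 2 + 4)) / 2)
    (hlam' : lam' = m - lam)
    (D : ℝ)
    (hD : D = m * (1 + p₀ * pm) - (2 + 2 * lam - m) * (-1 + p₀ * pm))
    (M : Matrix (Fin 4) (Fin 4) ℝ)
    (hM : M = !![(m : ℝ) - 1 + p₀ * pm, (m : ℝ) - 1 + p₀, 1 - p₀, 1;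
                 1 - p₀ * pm, 1 - p₀, p₀, 0;
                 1 - p₀ * pm, 1, 0, 0;
                 p₀ * pm, 0, 0, 0])
    (R : Fin 4 → ℝ)
    (hR : R = ![2 * (lam - 1) / D, 2 * (1 - p₀ * pm) / D,
                2 * (1 - p₀ * pm) / D, 2 * (1 + lam') * p₀ * pm / D]) :
    M.mulVec R = lam • R ∧ (∀ i, 0 < R i) ∧ ∑ i, R i = 1 := by
  have hm1 : (1 : ℝ) ≤ m := by exact_mod_cast hm
  have hs : Real.sqrt ((m : ℝ) ^ 2 + 4) ^ 2 = (m : ℝ) ^ 2 + 4 :=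
    Real.sq_sqrt (by positivity)
  have hsq : lam ^ 2 = m * lam + 1 := by
    rw [hlam]
    linear_combination hs / 4
  have hlam_gt : 1 < lam := by
    have : 1 < Real.sqrt ((m : ℝ) ^ 2 + 4) := by
      rw [Real.lt_sqrt zero_le_one]
      nlinarith
    linarith
  have hlam_lt : lam < m + 1 := by nlinarith
  have hlam'_pos : 0 < 1 + lam' := by linarith
  have hq_pos : 0 < p₀ * pm := mul_pos hp₀.1 hpm.1
  have hq_lt : p₀ * pm < 1 := mul_lt_one_of_nonneg_of_lt_one_left hp₀.1.le hp₀.2 hpm.2.le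
  have hR₀ : 0 < 2 * (lam - 1) := by linarith
  have hR₁ : 0 < 2 * (1 - p₀ * pm) := by linarith
  have hR₃ : 0 < 2 * (1 + lam') * p₀ * pm := by
    rw [mul_assoc]
    positivity
  have hsum : D = 2 * (lam - 1) + 2 * (1 - p₀ * pm) + 2 * (1 - p₀ * pm)
      + 2 * (1 + lam') * p₀ * pm := by
    rw [hD, hlam']
    ring
  have hD_pos : 0 < D := by linarith
  have hD_ne : D ≠ 0 := hD_pos.ne'
  subst hM hR hlam'
  refine ⟨?_, ?_, ?_⟩
  · ext i
    fin_cases i <;> simp [Matrix.mulVec, dotProduct, Fin.sum_univ_four]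
    · linear_combination (-2 / D) * hsq
    · ring
    · ring
    · linear_combination (2 * p₀ * pm / D) * hsq
  · intro i
    fin_cases i
    exacts [div_pos hR₀ hD_pos, div_pos hR₁ hD_pos, div_pos hR₁ hD_pos, div_pos hR₃ hD_pos]
  · simp only [Fin.sum_univ_four, Matrix.cons_val]
    rw [← add_div, ← add_div, ← add_div, ← hsum, div_self hD_ne]
end

section
/- Let m ≥ 1 be an integer and p₀, p_m ∈ (0,1). Let M_{m,2} be the 4×4 real matrix with rows (m−1+p₀p_m, m−1+p₀, 1−p₀, 1), (1−p₀p_m, 1−p₀, p₀, 0), (1−p₀p_m, 1, 0, 0), (p₀p_m, 0, 0, 0). Then M_{m,2} is primitive: there exists k ≥ 1 such that every entry of (M_{m,2})^k is strictly positive. -/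
/-- A nonnegative square matrix with a positive row and the matching column positive has a positive
square. -/
theorem Matrix.sq_apply_pos_of_row_col_pos {n : Type*} [Fintype n] [DecidableEq n]
    {A : Matrix n n ℝ} (a : n) (hA : ∀ i j, 0 ≤ A i j) (hrow : ∀ j, 0 < A a j)
    (hcol : ∀ i, 0 < A i a) (i j : n) : 0 < (A ^ 2) i j := by
  rw [pow_two, Matrix.mul_apply]
  exact Finset.sum_pos' (fun k _ => mul_nonneg (hA i k) (hA k j))
    ⟨a, Finset.mem_univ a, mul_pos (hcol i) (hrow j)⟩

theorem induced_matrix_primitive (m : ℕ) (hm : 1 ≤ m)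
    (p₀ pm : ℝ) (hp₀ : p₀ ∈ Set.Ioo (0 : ℝ) 1) (hpm : pm ∈ Set.Ioo (0 : ℝ) 1)
    (M : Matrix (Fin 4) (Fin 4) ℝ)
    (hM : M = !![(m : ℝ) - 1 + p₀ * pm, (m : ℝ) - 1 + p₀, 1 - p₀, 1;
                 1 - p₀ * pm, 1 - p₀, p₀, 0;
                 1 - p₀ * pm, 1, 0, 0;
                 p₀ * pm, 0, 0, 0]) :
    ∃ k : ℕ, 1 ≤ k ∧ ∀ i j, 0 < (M ^ k) i j := by
  obtain ⟨h0, h1⟩ := hp₀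
  obtain ⟨h2, h3⟩ := hpm
  have hm' : (1 : ℝ) ≤ m := by exact_mod_cast hm
  have hpos : 0 < p₀ * pm := mul_pos h0 h2
  have hlt : p₀ * pm < 1 := mul_lt_one_of_nonneg_of_lt_one_left h0.le h1 h3.le
  subst hM
  refine ⟨2, one_le_two, Matrix.sq_apply_pos_of_row_col_pos 0 ?_ ?_ ?_⟩
  · intro i j
    fin_cases i <;> fin_cases j <;> simp <;> linarith
  · intro j
    fin_cases j <;> simp <;> linarith
  · intro i
    fin_cases i <;> simp <;> linarith
end
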